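/- No ground term is E₀-equivalent to a proper subterm of itself. -/

import Mathlib

/-- Terms built from variables, free constants, two multiplication symbols
`mul` (*) and `cmul` (⊛), a binary symbol `exp`, and a unary symbol `g`. -/
inductive Tm : Type
  | var : ℕ → Tm
  | const : ℕ → Tm
  | mul : Tm → Tm → Tm
  | cmul : Tm → Tm → Tm
  | exp : Tm → Tm → Tm
  | g : Tm → Tm

/-- The equational theory E₀: the smallest congruence on terms, closed under
substitution (hence the axioms are stated for arbitrary terms), generated by
`exp(g(X),Y) = g(X ⊛ Y)` and `exp(X*Y,Z) = exp(X,Z) * exp(Y,Z)`. -/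
inductive E0 : Tm → Tm → Prop
  | ax1 (x y : Tm) : E0 (.exp (.g x) y) (.g (.cmul x y))
  | ax2 (x y z : Tm) : E0 (.exp (.mul x y) z) (.mul (.exp x z) (.exp y z))
  | refl (t : Tm) : E0 t t
  | symm {s t : Tm} : E0 s t → E0 t s
  | trans {s t u : Tm} : E0 s t → E0 t u → E0 s u
  | mul_congr {a b c d : Tm} : E0 a b → E0 c d → E0 (.mul a c) (.mul b d)
  | cmul_congr {a b c d : Tm} : E0 a b → E0 c d → E0 (.cmul a c) (.cmul b d)
  | exp_congr {a b c d : Tm} : E0 a b → E0 c d → E0 (.exp a c) (.exp b d)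
  | g_congr {a b : Tm} : E0 a b → E0 (.g a) (.g b)

/-- A ground term contains no variables. -/
def Tm.Ground : Tm → Prop
  | .var _ => False
  | .const _ => True
  | .mul s t => s.Ground ∧ t.Ground
  | .cmul s t => s.Ground ∧ t.Ground
  | .exp s t => s.Ground ∧ t.Ground
  | .g t => t.Ground


/-- `Subterm s t` : `s` is a subterm of `t` (reflexive-transitive subterm relation). -/
inductive Subterm : Tm → Tm → Prop
  | refl (t : Tm) : Subterm t t
  | mul_l {s a : Tm} (b : Tm) : Subterm s a → Subterm s (.mul a b)
  | mul_r (a : Tm) {s b : Tm} : Subterm s b → Subterm s (.mul a b)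
  | cmul_l {s a : Tm} (b : Tm) : Subterm s a → Subterm s (.cmul a b)
  | cmul_r (a : Tm) {s b : Tm} : Subterm s b → Subterm s (.cmul a b)
  | exp_l {s a : Tm} (b : Tm) : Subterm s a → Subterm s (.exp a b)
  | exp_r (a : Tm) {s b : Tm} : Subterm s b → Subterm s (.exp a b)
  | g_arg {s a : Tm} : Subterm s a → Subterm s (.g a)

/-- A size-like weight that is invariant under `E0` and strictly monotone in subterms. -/
def Tm.weight : Tm → ℕ
  | .var _ => 0
  | .const _ => 0
  | .mul s t => max s.weight t.weight + 1
  | .cmul s t => s.weight + t.weight + 1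
  | .exp s t => s.weight + t.weight + 1
  | .g t => t.weight + 1

theorem E0.weight_eq {s t : Tm} (h : E0 s t) : s.weight = t.weight := by
  induction h <;> grind [Tm.weight]

theorem Subterm.eq_or_weight_lt {s t : Tm} (h : Subterm s t) :
    s = t ∨ s.weight < t.weight := by
  induction h with
  | refl => exact Or.inl rfl
  | _ => rename_i ih; right; rcases ih with rfl | ih <;> simp only [Tm.weight] <;> omega

/-- No ground term is E₀-equivalent to a proper subterm of itself. -/
theorem no_ground_term_E0_equiv_proper_subterm (t s : Tm) (ht : t.Ground)
    (hsub : Subterm s t) (hne : s ≠ t) : ¬ E0 t s := by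
  intro h
  have hlt := hsub.eq_or_weight_lt.resolve_left hne
  exact hlt.ne h.weight_eq.symm
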